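/- (Proposition 3(b), supportability of the efficient schedule.) Assume the δ-hypothesis and that SYSTEM is feasible, and let (qᵇ*, qᵖ*, (r_s*)) be an optimal solution of SYSTEM. Then there exists a competitive equilibrium — in fact one with truthful bids αₙᵇ = γₙᵇ and αₙᵖ = γₙᵖ for every n — whose production schedule equals (qᵇ*, qᵖ*, (r_s*)). -/

import Mathlib

open Matrix Finset

noncomputable section

/-- Clamp `x` to the interval `[a,b]`: `[x]_a^b = min (max x a) b`. -/
def clamp (x a b : ℝ) : ℝ := min (max x a) b

/-- Data of the power network and market: oriented incidence matrix `C`,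
positive line susceptances `Bd`, line limits `f`, positive capacity bounds,
cost functions `cb`, `cp` on `(0,∞)` with derivatives `cb'`, `cp'` (strictly
increasing continuous bijections from `(0,∞)` onto `ℝ`, with inverses
`cbInv`, `cpInv`), and market constants `γb`, `γp`. -/
structure MarketNet (N L : ℕ) where
  C : Matrix (Fin N) (Fin L) ℝ
  Bd : Fin L → ℝ
  f : Fin L → ℝ
  qlb : Fin N → ℝ
  qub : Fin N → ℝ
  plb : Fin N → ℝ
  pub : Fin N → ℝ
  cb : Fin N → ℝ → ℝ
  cp : Fin N → ℝ → ℝ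
  cb' : Fin N → ℝ → ℝ
  cp' : Fin N → ℝ → ℝ
  cbInv : Fin N → ℝ → ℝ
  cpInv : Fin N → ℝ → ℝ
  γb : Fin N → ℝ
  γp : Fin N → ℝ

namespace MarketNet

variable {N L : ℕ} (P : MarketNet N L)

/-- The weighted Laplacian `Lap = C·B·Cᵀ`. -/
def Lap : Matrix (Fin N) (Fin N) ℝ := P.C * Matrix.diagonal P.Bd * P.Cᵀ

/-- The shift-factor matrix `H = B·Cᵀ·(Lap + (1/N)·𝟙𝟙ᵀ)⁻¹`. -/
def H : Matrix (Fin L) (Fin N) ℝ :=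
  Matrix.diagonal P.Bd * P.Cᵀ *
    (P.Lap + (N : ℝ)⁻¹ • Matrix.of (fun _ _ : Fin N => (1 : ℝ)))⁻¹

/-- Standing assumptions on the network and market data. -/
def Sane : Prop :=
  1 ≤ N ∧
  (∀ l, 0 < P.Bd l) ∧
  (∀ x : Fin N → ℝ, P.Cᵀ.mulVec x = 0 → ∃ c : ℝ, x = fun _ => c) ∧
  (∀ n, 0 < P.qlb n) ∧ (∀ n, P.qlb n ≤ P.qub n) ∧
  (∀ n, 0 < P.plb n) ∧ (∀ n, P.plb n ≤ P.pub n) ∧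
  (∀ n, ∀ x ∈ Set.Ioi (0 : ℝ), HasDerivAt (P.cb n) (P.cb' n x) x) ∧
  (∀ n, ∀ x ∈ Set.Ioi (0 : ℝ), HasDerivAt (P.cp n) (P.cp' n x) x) ∧
  (∀ n, StrictConvexOn ℝ (Set.Ioi 0) (P.cb n)) ∧
  (∀ n, StrictConvexOn ℝ (Set.Ioi 0) (P.cp n)) ∧
  (∀ n, StrictMonoOn (P.cb' n) (Set.Ioi 0)) ∧
  (∀ n, StrictMonoOn (P.cp' n) (Set.Ioi 0)) ∧
  (∀ n, ContinuousOn (P.cb' n) (Set.Ioi 0)) ∧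
  (∀ n, ContinuousOn (P.cp' n) (Set.Ioi 0)) ∧
  (∀ n y, P.cbInv n y ∈ Set.Ioi (0 : ℝ) ∧ P.cb' n (P.cbInv n y) = y) ∧
  (∀ n y, P.cpInv n y ∈ Set.Ioi (0 : ℝ) ∧ P.cp' n (P.cpInv n y) = y) ∧
  (∀ n, ∀ x ∈ Set.Ioi (0 : ℝ), P.cbInv n (P.cb' n x) = x) ∧
  (∀ n, ∀ x ∈ Set.Ioi (0 : ℝ), P.cpInv n (P.cp' n x) = x) ∧
  (∀ n, 0 < P.γb n) ∧ (∀ n, 0 < P.γp n)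

/-- Nodal injections `qᵇ + qᵖ + r − d`. -/
def inj (_P : MarketNet N L) (qb qp r d : Fin N → ℝ) : Fin N → ℝ :=
  fun n => qb n + qp n + r n - d n

/-- The feasible set `Ω(d)`. -/
def Omega (d qb qp r : Fin N → ℝ) : Prop :=
  (∀ n, P.qlb n ≤ qb n ∧ qb n ≤ P.qub n) ∧
  (∀ n, P.plb n ≤ qp n + r n ∧ qp n + r n ≤ P.pub n) ∧
  (∑ n, (qb n + qp n + r n - d n) = 0) ∧
  (∀ l, -P.f l ≤ P.H.mulVec (P.inj qb qp r d) l ∧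
        P.H.mulVec (P.inj qb qp r d) l ≤ P.f l)

/-- Nodal prices `π(λ,μ̲,μ̄) = λ·𝟙 + Hᵀ(μ̲ − μ̄)`. -/
def price (lam : ℝ) (μl μu : Fin L → ℝ) (n : Fin N) : ℝ :=
  lam + P.Hᵀ.mulVec (μl - μu) n

variable {S : Type} [Fintype S]

/-- The SYSTEM objective. -/
def sysCost (p : S → ℝ) (qb qp : Fin N → ℝ) (r : S → Fin N → ℝ) : ℝ :=
  ∑ s, p s * ∑ n, (P.cb n (qb n) + P.cp n (qp n + r s n))

/-- Feasibility for SYSTEM. -/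
def SysFeas (s1 : S) (d : S → Fin N → ℝ)
    (qb qp : Fin N → ℝ) (r : S → Fin N → ℝ) : Prop :=
  (∀ s, P.Omega (d s) qb qp (r s)) ∧ r s1 = 0

/-- Optimality for SYSTEM. -/
def SysOpt (s1 : S) (p : S → ℝ) (d : S → Fin N → ℝ)
    (qb qp : Fin N → ℝ) (r : S → Fin N → ℝ) : Prop :=
  P.SysFeas s1 d qb qp r ∧
  ∀ qb' qp' r', P.SysFeas s1 d qb' qp' r' →
    P.sysCost p qb qp r ≤ P.sysCost p qb' qp' r'

/-- The KKT system of SYSTEM at a feasible point. -/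
def SystemKKT (K : ℕ) (p : S → ℝ) (d : S → Fin N → ℝ)
    (qb qp : Fin N → ℝ) (r : S → Fin N → ℝ)
    (ξl ξu : Fin N → ℝ) (νl νu : S → Fin N → ℝ)
    (μl μu : S → Fin L → ℝ) (lam : S → ℝ) : Prop :=
  (∀ n, 0 ≤ ξl n) ∧ (∀ n, 0 ≤ ξu n) ∧
  (∀ s n, 0 ≤ νl s n) ∧ (∀ s n, 0 ≤ νu s n) ∧
  (∀ s l, 0 ≤ μl s l) ∧ (∀ s l, 0 ≤ μu s l) ∧
  (∀ n, (K : ℝ) * P.cb' n (qb n) + ξu n - ξl n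
      = ∑ s, p s * P.price (lam s) (μl s) (μu s) n) ∧
  (∑ n, (ξl n * (P.qlb n - qb n) + ξu n * (qb n - P.qub n)) = 0) ∧
  (∀ s n, P.cp' n (qp n + r s n) + νu s n - νl s n
      = P.price (lam s) (μl s) (μu s) n) ∧
  (∀ s, ∑ n, (νl s n * (P.plb n - (qp n + r s n))
            + νu s n * ((qp n + r s n) - P.pub n)) = 0) ∧
  (∀ s, ∑ l, (μl s l * (-P.f l - P.H.mulVec (P.inj qb qp (r s) (d s)) l)
            + μu s l * (P.H.mulVec (P.inj qb qp (r s) (d s)) l - P.f l)) = 0)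

/-- The δ-hypothesis: there are an optimal solution of SYSTEM and multipliers
satisfying the KKT system of SYSTEM at it such that
`δ_n = ∑_s p_s (π_n(λ_s,μ̲_s,μ̄_s) − π_n(λ₁,μ̲₁,μ̄₁))` for every `n`. -/
def DeltaHyp (s1 : S) (K : ℕ) (p : S → ℝ) (d : S → Fin N → ℝ)
    (δ : Fin N → ℝ) : Prop :=
  ∃ (qb qp : Fin N → ℝ) (r : S → Fin N → ℝ)
    (ξl ξu : Fin N → ℝ) (νl νu : S → Fin N → ℝ)
    (μl μu : S → Fin L → ℝ) (lam : S → ℝ),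
    P.SysOpt s1 p d qb qp r ∧
    P.SystemKKT K p d qb qp r ξl ξu νl νu μl μu lam ∧
    ∀ n, δ n = ∑ s, p s * (P.price (lam s) (μl s) (μu s) n
                         - P.price (lam s1) (μl s1) (μu s1) n)

/-- The dispatch supply function `sₙᵇ(π) = ((cₙᵇ)′)⁻¹(π)/γₙᵇ`. -/
def sb (n : Fin N) (π : ℝ) : ℝ := P.cbInv n π / P.γb n

/-- The regulation supply function `sₙᵖ(π) = ((cₙᵖ)′)⁻¹(π)/γₙᵖ`. -/
def sp (n : Fin N) (π : ℝ) : ℝ := P.cpInv n π / P.γp n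

/-- The dispatch bid cost `ĉₙᵇ(q) = ∫_{q̲ₙᵇ}^q (cₙᵇ)′((γₙᵇ/αₙᵇ)w) dw`. -/
def cbHat (αb : Fin N → ℝ) (n : Fin N) (q : ℝ) : ℝ :=
  ∫ w in (P.qlb n)..q, P.cb' n ((P.γb n / αb n) * w)

/-- The regulation bid cost `ĉₙᵖ(q) = ∫_{q̲ₙᵖ}^q (cₙᵖ)′((γₙᵖ/αₙᵖ)w) dw`. -/
def cpHat (αp : Fin N → ℝ) (n : Fin N) (q : ℝ) : ℝ :=
  ∫ w in (P.plb n)..q, P.cp' n ((P.γp n / αp n) * w)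

/-- The `ÊD` objective `∑_n (K ĉₙᵇ(qₙᵇ) + K ĉₙᵖ(qₙᵖ) − δ_n qₙᵇ)`. -/
def edHatCost (K : ℕ) (δ : Fin N → ℝ) (αb αp qb qp : Fin N → ℝ) : ℝ :=
  ∑ n, ((K : ℝ) * P.cbHat αb n (qb n) + (K : ℝ) * P.cpHat αp n (qp n)
        - δ n * qb n)

/-- Optimality for `ÊD(d₁)`. -/
def EDHatOpt (K : ℕ) (δ : Fin N → ℝ) (αb αp : Fin N → ℝ)
    (d1 qb qp : Fin N → ℝ) : Prop :=
  P.Omega d1 qb qp 0 ∧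
  ∀ qb' qp', P.Omega d1 qb' qp' 0 →
    P.edHatCost K δ αb αp qb qp ≤ P.edHatCost K δ αb αp qb' qp'

/-- The `F̂R` objective `∑_n ĉₙᵖ(qₙᵖ + r_{s,n})`. -/
def frHatCost (αp qp r : Fin N → ℝ) : ℝ := ∑ n, P.cpHat αp n (qp n + r n)

/-- Optimality for `F̂R(qᵇ,qᵖ,d_s)`. -/
def FRHatOpt (αp : Fin N → ℝ) (ds qb qp r : Fin N → ℝ) : Prop :=
  P.Omega ds qb qp r ∧
  ∀ r', P.Omega ds qb qp r' → P.frHatCost αp qp r ≤ P.frHatCost αp qp r'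

/-- The KKT system of `ÊD(d₁)`: the single-scenario analogue of SYSTEM's with
marginal costs `(cₙᵇ)′((γₙᵇ/αₙᵇ)·)`, `(cₙᵖ)′((γₙᵖ/αₙᵖ)·)` and the extra term
`−δ_n` in the `qᵇ`-stationarity condition. -/
def EDHatKKT (K : ℕ) (δ : Fin N → ℝ) (αb αp : Fin N → ℝ) (d1 qb qp : Fin N → ℝ)
    (ξl ξu νl νu : Fin N → ℝ) (μl μu : Fin L → ℝ) (lam : ℝ) : Prop :=
  (∀ n, 0 ≤ ξl n) ∧ (∀ n, 0 ≤ ξu n) ∧ (∀ n, 0 ≤ νl n) ∧ (∀ n, 0 ≤ νu n) ∧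
  (∀ l, 0 ≤ μl l) ∧ (∀ l, 0 ≤ μu l) ∧
  (∀ n, (K : ℝ) * P.cb' n ((P.γb n / αb n) * qb n) + ξu n - ξl n - δ n
      = P.price lam μl μu n) ∧
  (∀ n, (K : ℝ) * P.cp' n ((P.γp n / αp n) * qp n) + νu n - νl n
      = P.price lam μl μu n) ∧
  (∑ n, (ξl n * (P.qlb n - qb n) + ξu n * (qb n - P.qub n)) = 0) ∧
  (∑ n, (νl n * (P.plb n - qp n) + νu n * (qp n - P.pub n)) = 0) ∧
  (∑ l, (μl l * (-P.f l - P.H.mulVec (P.inj qb qp 0 d1) l)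
       + μu l * (P.H.mulVec (P.inj qb qp 0 d1) l - P.f l)) = 0)

/-- The KKT system of `F̂R(qᵇ,qᵖ,d_s)`. -/
def FRHatKKT (αp : Fin N → ℝ) (ds qb qp r : Fin N → ℝ)
    (νl νu : Fin N → ℝ) (μl μu : Fin L → ℝ) (lam : ℝ) : Prop :=
  (∀ n, 0 ≤ νl n) ∧ (∀ n, 0 ≤ νu n) ∧
  (∀ l, 0 ≤ μl l) ∧ (∀ l, 0 ≤ μu l) ∧
  (∀ n, P.cp' n ((P.γp n / αp n) * (qp n + r n)) + νu n - νl n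
      = P.price lam μl μu n) ∧
  (∑ n, (νl n * (P.plb n - (qp n + r n)) + νu n * ((qp n + r n) - P.pub n)) = 0) ∧
  (∑ l, (μl l * (-P.f l - P.H.mulVec (P.inj qb qp r ds) l)
       + μu l * (P.H.mulVec (P.inj qb qp r ds) l - P.f l)) = 0)

/-- Dispatch production setpoint `qₙᵇ = [αₙᵇ sₙᵇ(πₙᵇ)]` of the market. -/
def schedQb (αb πb : Fin N → ℝ) (n : Fin N) : ℝ :=
  clamp (αb n * P.sb n (πb n)) (P.qlb n) (P.qub n)

/-- Regulation production setpoint `qₙᵖ = [αₙᵖ sₙᵖ(π_{1,n}ᵖ)]` of the market. -/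
def schedQp (s1 : S) (αp : Fin N → ℝ) (πp : S → Fin N → ℝ) (n : Fin N) : ℝ :=
  clamp (αp n * P.sp n (πp s1 n)) (P.plb n) (P.pub n)

/-- Regulation recourse `r_{s,n} = [αₙᵖ sₙᵖ(π_{s,n}ᵖ)] − qₙᵖ` of the market. -/
def schedR (s1 : S) (αp : Fin N → ℝ) (πp : S → Fin N → ℝ) (s : S) (n : Fin N) : ℝ :=
  clamp (αp n * P.sp n (πp s n)) (P.plb n) (P.pub n) - P.schedQp s1 αp πp n

/-- Competitive equilibrium (Definition 2): bids `(αᵇ,αᵖ)` and prices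
`(πᵇ,(π_sᵖ))` such that (a) each `αₙᵇ` maximizes the dispatch generator's
profit, (b) each `αₙᵖ` maximizes the regulation generator's expected profit,
(c) the prices `πᵇ` and `π₁ᵖ` come from KKT multipliers at an optimal solution
of `ÊD(d₁)`, and (d) each `π_sᵖ` comes from KKT multipliers at an optimal
solution of `F̂R(qᵇ,qᵖ,d_s)` evaluated at the market production setpoints. -/
def CompetitiveEquilibrium (s1 : S) (K : ℕ) (p : S → ℝ) (d : S → Fin N → ℝ)
    (δ : Fin N → ℝ) (αb αp : Fin N → ℝ) (πb : Fin N → ℝ)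
    (πp : S → Fin N → ℝ) : Prop :=
  (∀ n, 0 < αb n) ∧ (∀ n, 0 < αp n) ∧
  -- (a)
  (∀ n, ∀ α > (0 : ℝ),
    (K : ℝ) * (πb n * clamp (α * P.sb n (πb n)) (P.qlb n) (P.qub n)
      - P.cb n (clamp (α * P.sb n (πb n)) (P.qlb n) (P.qub n))) ≤
    (K : ℝ) * (πb n * clamp (αb n * P.sb n (πb n)) (P.qlb n) (P.qub n)
      - P.cb n (clamp (αb n * P.sb n (πb n)) (P.qlb n) (P.qub n)))) ∧
  -- (b)
  (∀ n, ∀ α > (0 : ℝ),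
    ∑ s, p s * (πp s n * clamp (α * P.sp n (πp s n)) (P.plb n) (P.pub n)
      - P.cp n (clamp (α * P.sp n (πp s n)) (P.plb n) (P.pub n))) ≤
    ∑ s, p s * (πp s n * clamp (αp n * P.sp n (πp s n)) (P.plb n) (P.pub n)
      - P.cp n (clamp (αp n * P.sp n (πp s n)) (P.plb n) (P.pub n)))) ∧
  -- (c)
  (∃ (qb qp : Fin N → ℝ) (ξl ξu νl νu : Fin N → ℝ) (μl μu : Fin L → ℝ) (lam : ℝ),
    P.EDHatOpt K δ αb αp (d s1) qb qp ∧
    P.EDHatKKT K δ αb αp (d s1) qb qp ξl ξu νl νu μl μu lam ∧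
    (∀ n, πb n = ((K : ℝ))⁻¹ * (P.price lam μl μu n + δ n)) ∧
    (∀ n, πp s1 n = ((K : ℝ))⁻¹ * P.price lam μl μu n)) ∧
  -- (d)
  (∀ s : S, ∃ (r : Fin N → ℝ) (νl νu : Fin N → ℝ) (μl μu : Fin L → ℝ) (lam : ℝ),
    P.FRHatOpt αp (d s) (P.schedQb αb πb) (P.schedQp s1 αp πp) r ∧
    P.FRHatKKT αp (d s) (P.schedQb αb πb) (P.schedQp s1 αp πp) r
      νl νu μl μu lam ∧
    (∀ n, πp s n = P.price lam μl μu n))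

end MarketNet

/-- A convex function lies above its tangent lines. -/
theorem ConvexOn.add_mul_sub_le_of_hasDerivAt {s : Set ℝ} {c : ℝ → ℝ} {c' x y : ℝ}
    (hc : ConvexOn ℝ s c) (hx : x ∈ s) (hy : y ∈ s) (hd : HasDerivAt c c' x) :
    c x + c' * (y - x) ≤ c y := by
  rcases lt_trichotomy x y with h | h | h
  · have h1 := hc.le_slope_of_hasDerivAt hx hy h hd
    rw [slope_def_field, le_div_iff₀ (by linarith)] at h1
    linarith
  · simp [h]
  · have h1 := hc.slope_le_of_hasDerivAt hy hx h hd
    rw [slope_def_field, div_le_iff₀ (by linarith)] at h1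
    linarith

/-- A point satisfying the KKT conditions of the one-dimensional problem
`min k * c y - w * y` over `[a, b]` is optimal. -/
theorem ConvexOn.sub_mul_le_of_kkt {s : Set ℝ} {c : ℝ → ℝ} {c' k w a b q y u v : ℝ}
    (hc : ConvexOn ℝ s c) (hq : q ∈ s) (hy : y ∈ s) (hd : HasDerivAt c c' q)
    (hk : 0 ≤ k) (hv : 0 ≤ v) (hu : 0 ≤ u) (hstat : k * c' + u - v = w)
    (hva : v * (a - q) = 0) (hub : u * (q - b) = 0) (hay : a ≤ y) (hyb : y ≤ b) :
    k * c q - w * q ≤ k * c y - w * y := by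
  have h1 := mul_le_mul_of_nonneg_left (hc.add_mul_sub_le_of_hasDerivAt hq hy hd) hk
  have h2 := mul_nonneg hv (sub_nonneg.2 hay)
  have h3 := mul_nonneg hu (sub_nonneg.2 hyb)
  subst hstat
  linarith

theorem le_clamp {x a b : ℝ} (h : a ≤ b) : a ≤ clamp x a b :=
  le_min (le_max_right _ _) h

theorem clamp_le {x a b : ℝ} : clamp x a b ≤ b :=
  min_le_right _ _

/-- The KKT point on `[a, b]` is the clamped unconstrained optimizer `x`. -/
theorem clamp_eq_of_kkt {c' : ℝ → ℝ} {k w a b q x u v : ℝ}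
    (hc' : StrictMonoOn c' (Set.Ioi 0)) (hk : 0 < k) (hx : 0 < x) (ha : 0 < a)
    (haq : a ≤ q) (hqb : q ≤ b) (hv : 0 ≤ v) (hu : 0 ≤ u) (hstat : k * c' q + u - v = w)
    (hxw : k * c' x = w) (hva : v * (a - q) = 0) (hub : u * (q - b) = 0) :
    clamp x a b = q := by
  have hq : 0 < q := ha.trans_le haq
  unfold clamp
  rcases lt_trichotomy x q with h | h | h
  · have h1 := mul_lt_mul_of_pos_left (hc' hx hq h) hk
    have h2 : a - q = 0 := (mul_eq_zero.1 hva).resolve_left (by intro h0; linarith)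
    rw [max_eq_right (by linarith), min_eq_left (by linarith)]
    linarith
  · rw [h, max_eq_left haq, min_eq_left hqb]
  · have h1 := mul_lt_mul_of_pos_left (hc' hq hx h) hk
    have h2 : q - b = 0 := (mul_eq_zero.1 hub).resolve_left (by intro h0; linarith)
    rw [max_eq_left (by linarith), min_eq_right (by linarith)]
    linarith

/-- A vanishing aggregate complementary slackness sum vanishes termwise. -/
theorem complementary_slackness_apply {ι : Type*} [Fintype ι] {v u a b q : ι → ℝ}
    (hv : ∀ i, 0 ≤ v i) (hu : ∀ i, 0 ≤ u i) (haq : ∀ i, a i ≤ q i) (hqb : ∀ i, q i ≤ b i)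
    (h : ∑ i, (v i * (a i - q i) + u i * (q i - b i)) = 0) (i : ι) :
    v i * (a i - q i) = 0 ∧ u i * (q i - b i) = 0 := by
  have h1 : ∀ i, v i * (a i - q i) ≤ 0 := fun i =>
    mul_nonpos_of_nonneg_of_nonpos (hv i) (sub_nonpos.2 (haq i))
  have h2 : ∀ i, u i * (q i - b i) ≤ 0 := fun i =>
    mul_nonpos_of_nonneg_of_nonpos (hu i) (sub_nonpos.2 (hqb i))
  have h3 := (Finset.sum_eq_zero_iff_of_nonpos
    (fun i _ => add_nonpos (h1 i) (h2 i))).1 h i (Finset.mem_univ i)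
  constructor <;> linarith [h1 i, h2 i]

theorem StrictConvexOn.midpoint_le {c : ℝ → ℝ} (hc : StrictConvexOn ℝ (Set.Ioi 0) c)
    {x y : ℝ} (hx : 0 < x) (hy : 0 < y) : c ((x + y) / 2) ≤ (c x + c y) / 2 := by
  have h := hc.convexOn.2 (Set.mem_Ioi.2 hx) (Set.mem_Ioi.2 hy)
    (by norm_num : (0 : ℝ) ≤ 1 / 2) (by norm_num : (0 : ℝ) ≤ 1 / 2) (by norm_num)
  simp only [smul_eq_mul] at h
  rw [show (x + y) / 2 = 1 / 2 * x + 1 / 2 * y by ring]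
  linarith

theorem StrictConvexOn.eq_of_midpoint_eq {c : ℝ → ℝ} (hc : StrictConvexOn ℝ (Set.Ioi 0) c)
    {x y : ℝ} (hx : 0 < x) (hy : 0 < y) (h : c ((x + y) / 2) = (c x + c y) / 2) :
    x = y := by
  by_contra hne
  have h1 := hc.2 (Set.mem_Ioi.2 hx) (Set.mem_Ioi.2 hy) hne
    (by norm_num : (0 : ℝ) < 1 / 2) (by norm_num : (0 : ℝ) < 1 / 2) (by norm_num)
  simp only [smul_eq_mul] at h1
  rw [show (x + y) / 2 = 1 / 2 * x + 1 / 2 * y by ring] at h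
  linarith

/-- The fundamental theorem of calculus on the positive half-line. -/
theorem integral_eq_sub_of_hasDerivAt_Ioi {c c' : ℝ → ℝ}
    (hd : ∀ x ∈ Set.Ioi (0 : ℝ), HasDerivAt c (c' x) x) (hcont : ContinuousOn c' (Set.Ioi 0))
    {a q : ℝ} (ha : 0 < a) (hq : 0 < q) : ∫ w in a..q, c' w = c q - c a := by
  have hsub : Set.uIcc a q ⊆ Set.Ioi 0 := fun x hx => (lt_min ha hq).trans_le hx.1
  exact intervalIntegral.integral_eq_sub_of_hasDerivAt (fun x hx => hd x (hsub hx))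
    (hcont.mono hsub).intervalIntegrable

namespace MarketNet

theorem cbHat_truthful {N L : ℕ} {P : MarketNet N L} (hP : P.Sane) (n : Fin N) {q : ℝ}
    (hq : 0 < q) : P.cbHat P.γb n q = P.cb n q - P.cb n (P.qlb n) := by
  obtain ⟨-, -, -, hql, -, -, -, hdb, -, -, -, -, -, hcb, -, -, -, -, -, hγ, -⟩ := hP
  simp only [cbHat, div_self (hγ n).ne', one_mul]
  exact integral_eq_sub_of_hasDerivAt_Ioi (hdb n) (hcb n) (hql n) hq

theorem cpHat_truthful {N L : ℕ} {P : MarketNet N L} (hP : P.Sane) (n : Fin N) {q : ℝ}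
    (hq : 0 < q) : P.cpHat P.γp n q = P.cp n q - P.cp n (P.plb n) := by
  obtain ⟨-, -, -, -, -, hpl, -, -, hdp, -, -, -, -, -, hcp, -, -, -, -, -, hγ⟩ := hP
  simp only [cpHat, div_self (hγ n).ne', one_mul]
  exact integral_eq_sub_of_hasDerivAt_Ioi (hdp n) (hcp n) (hpl n) hq

theorem price_mul {N L : ℕ} (P : MarketNet N L) (k lam : ℝ) (μl μu : Fin L → ℝ) (n : Fin N) :
    P.price (k * lam) (k • μl) (k • μu) n = k * P.price lam μl μu n := by
  simp only [price, ← smul_sub, Matrix.mulVec_smul, Pi.smul_apply, smul_eq_mul]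
  ring

/-- The value of an injection vector at nodal prices, in terms of line flows. -/
theorem sum_price_mul {N L : ℕ} (P : MarketNet N L) (lam : ℝ) (μl μu : Fin L → ℝ)
    (x : Fin N → ℝ) :
    ∑ n, P.price lam μl μu n * x n
      = lam * ∑ n, x n + ∑ l, (μl l - μu l) * P.H.mulVec x l := by
  simp only [price, add_mul, Finset.sum_add_distrib, Finset.mul_sum]
  congr 1
  have h := Matrix.dotProduct_mulVec (μl - μu) P.H x
  rw [← Matrix.mulVec_transpose] at h
  simpa [dotProduct] using h.symm

/-- At KKT multipliers, any feasible injection costs at least as much at the nodal prices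
as the given one. -/
theorem sum_price_mul_inj_le {N L : ℕ} (P : MarketNet N L) {lam : ℝ} {μl μu : Fin L → ℝ}
    {d qb qp r qb' qp' r' : Fin N → ℝ} (hμl : ∀ l, 0 ≤ μl l) (hμu : ∀ l, 0 ≤ μu l)
    (h : P.Omega d qb qp r) (h' : P.Omega d qb' qp' r')
    (hcs : ∑ l, (μl l * (-P.f l - P.H.mulVec (P.inj qb qp r d) l)
            + μu l * (P.H.mulVec (P.inj qb qp r d) l - P.f l)) = 0) :
    ∑ n, P.price lam μl μu n * (qb n + qp n + r n)
      ≤ ∑ n, P.price lam μl μu n * (qb' n + qp' n + r' n) := by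
  have e := P.sum_price_mul lam μl μu (P.inj qb qp r d)
  have e' := P.sum_price_mul lam μl μu (P.inj qb' qp' r' d)
  have z : ∑ n, P.inj qb qp r d n = 0 := h.2.2.1
  have z' : ∑ n, P.inj qb' qp' r' d n = 0 := h'.2.2.1
  rw [z] at e
  rw [z'] at e'
  have hl : ∑ l, (μl l - μu l) * P.H.mulVec (P.inj qb qp r d) l
      ≤ ∑ l, (μl l - μu l) * P.H.mulVec (P.inj qb' qp' r' d) l := by
    have h0 : 0 ≤ ∑ l, (((μl l - μu l) * P.H.mulVec (P.inj qb' qp' r' d) l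
        - (μl l - μu l) * P.H.mulVec (P.inj qb qp r d) l)
        - (μl l * (-P.f l - P.H.mulVec (P.inj qb qp r d) l)
            + μu l * (P.H.mulVec (P.inj qb qp r d) l - P.f l))) := by
      refine Finset.sum_nonneg fun l _ => ?_
      have a1 := mul_nonneg (hμl l) (by linarith [(h'.2.2.2 l).1] :
        0 ≤ P.H.mulVec (P.inj qb' qp' r' d) l + P.f l)
      have a2 := mul_nonneg (hμu l) (sub_nonneg.2 (h'.2.2.2 l).2)
      linarith
    rw [Finset.sum_sub_distrib, hcs, Finset.sum_sub_distrib] at h0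
    linarith
  have hi : ∀ qb qp r : Fin N → ℝ, ∑ n, P.price lam μl μu n * P.inj qb qp r d n
      = ∑ n, P.price lam μl μu n * (qb n + qp n + r n)
        - ∑ n, P.price lam μl μu n * d n := fun qb qp r => by
    rw [← Finset.sum_sub_distrib]
    exact Finset.sum_congr rfl fun n _ => by simp only [inj]; ring
  rw [hi] at e e'
  linarith

theorem Omega.midpoint {N L : ℕ} {P : MarketNet N L} {d qb qp r qb' qp' r' : Fin N → ℝ}
    (h : P.Omega d qb qp r) (h' : P.Omega d qb' qp' r') :
    P.Omega d (fun n => (qb n + qb' n) / 2) (fun n => (qp n + qp' n) / 2)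
      (fun n => (r n + r' n) / 2) := by
  obtain ⟨h1, h2, h3, h4⟩ := h
  obtain ⟨h1', h2', h3', h4'⟩ := h'
  have hinj : P.inj (fun n => (qb n + qb' n) / 2) (fun n => (qp n + qp' n) / 2)
      (fun n => (r n + r' n) / 2) d
      = (1 / 2 : ℝ) • (P.inj qb qp r d + P.inj qb' qp' r' d) := by
    funext n
    simp only [inj, Pi.smul_apply, Pi.add_apply, smul_eq_mul]
    ring
  refine ⟨fun n => ?_, fun n => ?_, ?_, fun l => ?_⟩
  · constructor <;> linarith [h1 n, h1' n]
  · constructor <;> linarith [h2 n, h2' n]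
  · change ∑ n, P.inj (fun n => (qb n + qb' n) / 2) (fun n => (qp n + qp' n) / 2)
      (fun n => (r n + r' n) / 2) d n = 0
    rw [hinj]
    have z : ∑ n, P.inj qb qp r d n = 0 := h3
    have z' : ∑ n, P.inj qb' qp' r' d n = 0 := h3'
    simp only [Pi.smul_apply, Pi.add_apply, smul_eq_mul]
    rw [← Finset.mul_sum, Finset.sum_add_distrib, z, z']
    norm_num
  · rw [hinj, Matrix.mulVec_smul, Matrix.mulVec_add]
    simp only [Pi.smul_apply, Pi.add_apply, smul_eq_mul]
    constructor <;> linarith [h4 l, h4' l]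

/-- By strict convexity, SYSTEM has at most one optimal solution. -/
theorem SysOpt.unique {N L : ℕ} {P : MarketNet N L} (hP : P.Sane) {S : Type} [Fintype S]
    {s1 : S} {p : S → ℝ} (hp : ∀ s, 0 < p s) {d : S → Fin N → ℝ}
    {qb qp qb' qp' : Fin N → ℝ} {r r' : S → Fin N → ℝ}
    (h : P.SysOpt s1 p d qb qp r) (h' : P.SysOpt s1 p d qb' qp' r') :
    qb = qb' ∧ qp = qp' ∧ r = r' := by
  obtain ⟨-, -, -, hql, -, hpl, -, -, -, hcb, hcp, -⟩ := hP
  obtain ⟨⟨hΩ, hr1⟩, hmin⟩ := h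
  obtain ⟨⟨hΩ', hr1'⟩, hmin'⟩ := h'
  have hle := hmin _ _ _ ⟨fun s => (hΩ s).midpoint (hΩ' s), by
    funext n; simp [hr1, hr1']⟩
  have heq : P.sysCost p qb qp r = P.sysCost p qb' qp' r' :=
    le_antisymm (hmin _ _ _ ⟨hΩ', hr1'⟩) (hmin' _ _ _ ⟨hΩ, hr1⟩)
  have posb : ∀ n, 0 < qb n := fun n => (hql n).trans_le ((hΩ s1).1 n).1
  have posb' : ∀ n, 0 < qb' n := fun n => (hql n).trans_le ((hΩ' s1).1 n).1
  have posp : ∀ s n, 0 < qp n + r s n := fun s n => (hpl n).trans_le ((hΩ s).2.1 n).1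
  have posp' : ∀ s n, 0 < qp' n + r' s n := fun s n => (hpl n).trans_le ((hΩ' s).2.1 n).1
  have hmid : ∀ s n, (qp n + qp' n) / 2 + (r s n + r' s n) / 2
      = ((qp n + r s n) + (qp' n + r' s n)) / 2 := fun s n => by ring
  have hb : ∀ n, P.cb n ((qb n + qb' n) / 2) ≤ (P.cb n (qb n) + P.cb n (qb' n)) / 2 :=
    fun n => (hcb n).midpoint_le (posb n) (posb' n)
  have hq : ∀ s n, P.cp n ((qp n + qp' n) / 2 + (r s n + r' s n) / 2)
      ≤ (P.cp n (qp n + r s n) + P.cp n (qp' n + r' s n)) / 2 := fun s n => by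
    rw [hmid]
    exact (hcp n).midpoint_le (posp s n) (posp' s n)
  set gap : S → Fin N → ℝ := fun s n =>
    (P.cb n (qb n) + P.cp n (qp n + r s n) + (P.cb n (qb' n) + P.cp n (qp' n + r' s n))) / 2
      - (P.cb n ((qb n + qb' n) / 2) + P.cp n ((qp n + qp' n) / 2 + (r s n + r' s n) / 2))
    with hgap
  have hgap0 : ∀ s n, 0 ≤ gap s n := fun s n => by
    simp only [hgap]
    linarith [hb n, hq s n]
  have hsum : ∑ s, p s * ∑ n, gap s n
      = (P.sysCost p qb qp r + P.sysCost p qb' qp' r') / 2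
        - P.sysCost p (fun n => (qb n + qb' n) / 2) (fun n => (qp n + qp' n) / 2)
          (fun s n => (r s n + r' s n) / 2) := by
    simp only [sysCost, hgap, Finset.sum_sub_distrib, ← Finset.sum_div, Finset.sum_add_distrib,
      mul_sub, mul_add, mul_div_assoc', add_div]
  have hz : ∑ s, p s * ∑ n, gap s n = 0 :=
    le_antisymm (by rw [hsum]; linarith)
      (Finset.sum_nonneg fun s _ => mul_nonneg (hp s).le
        (Finset.sum_nonneg fun n _ => hgap0 s n))
  have hgz : ∀ s n, gap s n = 0 := fun s n => by
    have h1 := (Finset.sum_eq_zero_iff_of_nonneg fun s _ => mul_nonneg (hp s).le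
        (Finset.sum_nonneg fun n _ => hgap0 s n)).1 hz s (Finset.mem_univ s)
    have h2 := (mul_eq_zero.1 h1).resolve_left (hp s).ne'
    exact (Finset.sum_eq_zero_iff_of_nonneg fun n _ => hgap0 s n).1 h2 n (Finset.mem_univ n)
  have eb : ∀ n, qb n = qb' n := fun n =>
    (hcb n).eq_of_midpoint_eq (posb n) (posb' n) (by
      have := hgz s1 n
      simp only [hgap] at this
      linarith [hb n, hq s1 n])
  have ep : ∀ s n, qp n + r s n = qp' n + r' s n := fun s n =>
    (hcp n).eq_of_midpoint_eq (posp s n) (posp' s n) (by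
      have := hgz s n
      simp only [hgap] at this
      rw [← hmid]
      linarith [hb n, hq s n])
  have eqp : ∀ n, qp n = qp' n := fun n => by simpa [hr1, hr1'] using ep s1 n
  refine ⟨funext eb, funext eqp, funext fun s => funext fun n => ?_⟩
  linarith [ep s n, eqp n]

/-- With truthful bids, the KKT conditions of `ÊD` are sufficient for optimality. -/
theorem EDHatKKT.edHatOpt {N L : ℕ} {P : MarketNet N L} (hP : P.Sane) {K : ℕ}
    {δ d qb qp ξl ξu νl νu : Fin N → ℝ} {μl μu : Fin L → ℝ} {lam : ℝ}
    (hΩ : P.Omega d qb qp 0)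
    (h : P.EDHatKKT K δ P.γb P.γp d qb qp ξl ξu νl νu μl μu lam) :
    P.EDHatOpt K δ P.γb P.γp d qb qp := by
  have hP' := hP
  obtain ⟨-, -, -, hql, -, hpl, -, hdb, hdp, hcb, hcp, -, -, -, -, -, -, -, -, hγb, hγp⟩ := hP'
  obtain ⟨hξl, hξu, hνl, hνu, hμl, hμu, hstb, hstp, hcsb, hcsp, hcsl⟩ := h
  refine ⟨hΩ, fun qb' qp' hΩ' => ?_⟩
  have hcsb := complementary_slackness_apply hξl hξu (fun n => (hΩ.1 n).1)
    (fun n => (hΩ.1 n).2) hcsb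
  have boxp : ∀ n, P.plb n ≤ qp n ∧ qp n ≤ P.pub n := fun n => by simpa using hΩ.2.1 n
  have boxp' : ∀ n, P.plb n ≤ qp' n ∧ qp' n ≤ P.pub n := fun n => by simpa using hΩ'.2.1 n
  have hcsp := complementary_slackness_apply hνl hνu (fun n => (boxp n).1)
    (fun n => (boxp n).2) hcsp
  have hval := P.sum_price_mul_inj_le (lam := lam) hμl hμu hΩ hΩ' hcsl
  have hterm : ∀ n, ((K : ℝ) * P.cbHat P.γb n (qb n) + (K : ℝ) * P.cpHat P.γp n (qp n)
        - δ n * qb n) - P.price lam μl μu n * (qb n + qp n + (0 : Fin N → ℝ) n)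
      ≤ ((K : ℝ) * P.cbHat P.γb n (qb' n) + (K : ℝ) * P.cpHat P.γp n (qp' n)
        - δ n * qb' n) - P.price lam μl μu n * (qb' n + qp' n + (0 : Fin N → ℝ) n) := fun n => by
    have b0 := (hql n).trans_le (hΩ.1 n).1
    have b0' := (hql n).trans_le (hΩ'.1 n).1
    have p0 := (hpl n).trans_le (boxp n).1
    have p0' := (hpl n).trans_le (boxp' n).1
    have sb := hstb n
    have sp := hstp n
    rw [div_self (hγb n).ne', one_mul] at sb
    rw [div_self (hγp n).ne', one_mul] at sp
    have t1 := (hcb n).convexOn.sub_mul_le_of_kkt (w := P.price lam μl μu n + δ n) b0 b0'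
      (hdb n _ b0) K.cast_nonneg (hξl n)
      (hξu n) (by linarith) (hcsb n).1 (hcsb n).2 (hΩ'.1 n).1 (hΩ'.1 n).2
    have t2 := (hcp n).convexOn.sub_mul_le_of_kkt p0 p0' (hdp n _ p0) K.cast_nonneg (hνl n)
      (hνu n) sp (hcsp n).1 (hcsp n).2 (boxp' n).1 (boxp' n).2
    rw [cbHat_truthful hP n b0, cbHat_truthful hP n b0', cpHat_truthful hP n p0,
      cpHat_truthful hP n p0']
    simp only [Pi.zero_apply]
    linarith
  have hs := Finset.sum_le_sum fun n (_ : n ∈ Finset.univ) => hterm n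
  simp only [Finset.sum_sub_distrib] at hs
  simp only [edHatCost, Finset.sum_sub_distrib]
  linarith

/-- With truthful bids, the KKT conditions of `F̂R` are sufficient for optimality. -/
theorem FRHatKKT.frHatOpt {N L : ℕ} {P : MarketNet N L} (hP : P.Sane)
    {d qb qp r νl νu : Fin N → ℝ} {μl μu : Fin L → ℝ} {lam : ℝ}
    (hΩ : P.Omega d qb qp r) (h : P.FRHatKKT P.γp d qb qp r νl νu μl μu lam) :
    P.FRHatOpt P.γp d qb qp r := by
  have hP' := hP
  obtain ⟨-, -, -, -, -, hpl, -, -, hdp, -, hcp, -, -, -, -, -, -, -, -, -, hγp⟩ := hP'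
  obtain ⟨hνl, hνu, hμl, hμu, hstp, hcsp, hcsl⟩ := h
  refine ⟨hΩ, fun r' hΩ' => ?_⟩
  have hcsp := complementary_slackness_apply hνl hνu (fun n => (hΩ.2.1 n).1)
    (fun n => (hΩ.2.1 n).2) hcsp
  have hval := P.sum_price_mul_inj_le (lam := lam) hμl hμu hΩ hΩ' hcsl
  have hterm : ∀ n, P.cpHat P.γp n (qp n + r n) - P.price lam μl μu n * (qb n + qp n + r n)
      ≤ P.cpHat P.γp n (qp n + r' n)
        - P.price lam μl μu n * (qb n + qp n + r' n) := fun n => by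
    have p0 := (hpl n).trans_le (hΩ.2.1 n).1
    have p0' := (hpl n).trans_le (hΩ'.2.1 n).1
    have sp := hstp n
    rw [div_self (hγp n).ne', one_mul] at sp
    have t := (hcp n).convexOn.sub_mul_le_of_kkt (w := P.price lam μl μu n) p0 p0'
      (hdp n _ p0) zero_le_one (hνl n) (hνu n) (by rw [one_mul, sp]) (hcsp n).1 (hcsp n).2
      (hΩ'.2.1 n).1 (hΩ'.2.1 n).2
    rw [cpHat_truthful hP n p0, cpHat_truthful hP n p0']
    linarith
  have hs := Finset.sum_le_sum fun n (_ : n ∈ Finset.univ) => hterm n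
  rw [Finset.sum_sub_distrib, Finset.sum_sub_distrib] at hs
  unfold frHatCost
  linarith

end MarketNet

/-- **Proposition 3(b), supportability of the efficient
schedule.** Assume the δ-hypothesis and that SYSTEM is feasible, and let
`(qᵇ*, qᵖ*, (r_s*))` be an optimal solution of SYSTEM. Then there exists a
competitive equilibrium — in fact one with truthful bids `αₙᵇ = γₙᵇ` and
`αₙᵖ = γₙᵖ` for every `n` — whose production schedule equals
`(qᵇ*, qᵖ*, (r_s*))`. -/
theorem efficient_schedule_supportable
    {N L : ℕ} (P : MarketNet N L) (hP : P.Sane)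
    {S : Type} [Fintype S] (s1 : S)
    (K : ℕ) (hK : 1 ≤ K)
    (p : S → ℝ) (hp : ∀ s, 0 < p s) (hpsum : ∑ s, p s = (K : ℝ)) (hp1 : p s1 = 1)
    (d : S → Fin N → ℝ) (δ : Fin N → ℝ)
    (hδ : P.DeltaHyp s1 K p d δ)
    (qbs qps : Fin N → ℝ) (rs : S → Fin N → ℝ)
    (hfeas : P.SysFeas s1 d qbs qps rs)
    (hopt : P.SysOpt s1 p d qbs qps rs) :
    ∃ (πb : Fin N → ℝ) (πp : S → Fin N → ℝ),
      P.CompetitiveEquilibrium s1 K p d δ P.γb P.γp πb πp ∧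
      P.schedQb P.γb πb = qbs ∧
      P.schedQp s1 P.γp πp = qps ∧
      ∀ s, P.schedR s1 P.γp πp s = rs s := by
  obtain ⟨qb, qp, r, ξl, ξu, νl, νu, μl, μu, lam, hopt', hkkt, hδ⟩ := hδ
  obtain ⟨rfl, rfl, rfl⟩ := hopt'.unique hP hp hopt
  obtain ⟨hξl, hξu, hνl, hνu, hμl, hμu, hstb, hcsb, hstp, hcsp, hcsl⟩ := hkkt
  obtain ⟨hΩ, hr1⟩ := hfeas
  have hP' := hP
  obtain ⟨-, -, -, hql, hqlu, hpl, hplu, hdb, hdp, hcb, hcp, hmb, hmp, -, -, hib, hip, -, -,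
    hγb, hγp⟩ := hP'
  have hK0 : (0 : ℝ) < K := by exact_mod_cast hK
  have csb := complementary_slackness_apply hξl hξu (fun n => ((hΩ s1).1 n).1)
    (fun n => ((hΩ s1).1 n).2) hcsb
  have csp := fun s => complementary_slackness_apply (hνl s) (hνu s)
    (fun n => ((hΩ s).2.1 n).1) (fun n => ((hΩ s).2.1 n).2) (hcsp s)
  set πp : S → Fin N → ℝ := fun s => P.price (lam s) (μl s) (μu s) with hπp
  have hδ' : ∀ n, ∑ s, p s * πp s n = K * πp s1 n + δ n := fun n => by
    rw [hδ n]
    simp only [mul_sub, Finset.sum_sub_distrib, ← Finset.sum_mul, hpsum, hπp]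
    ring
  set πb : Fin N → ℝ := fun n => (K : ℝ)⁻¹ * (K * πp s1 n + δ n) with hπb
  have hKπb : ∀ n, (K : ℝ) * πb n = K * πp s1 n + δ n := fun n => by
    rw [hπb]; exact mul_inv_cancel_left₀ hK0.ne' _
  have hstb' : ∀ n, (K : ℝ) * P.cb' n (qb n) + ξu n - ξl n = K * πb n := fun n => by
    rw [hKπb, ← hδ', hstb]
  have hstp' : ∀ s n, 1 * P.cp' n (qp n + r s n) + νu s n - νl s n = πp s n := fun s n => by
    rw [one_mul, hstp]
  have clb : ∀ n, clamp (P.γb n * P.sb n (πb n)) (P.qlb n) (P.qub n) = qb n := fun n => by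
    rw [MarketNet.sb, mul_div_cancel₀ _ (hγb n).ne']
    exact clamp_eq_of_kkt (hmb n) hK0 (hib n _).1 (hql n) ((hΩ s1).1 n).1 ((hΩ s1).1 n).2
      (hξl n) (hξu n) (hstb' n) (by rw [(hib n _).2]) (csb n).1 (csb n).2
  have clp : ∀ s n, clamp (P.γp n * P.sp n (πp s n)) (P.plb n) (P.pub n) = qp n + r s n :=
    fun s n => by
      rw [MarketNet.sp, mul_div_cancel₀ _ (hγp n).ne']
      exact clamp_eq_of_kkt (hmp n) one_pos (hip n _).1 (hpl n) ((hΩ s).2.1 n).1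
        ((hΩ s).2.1 n).2 (hνl s n) (hνu s n) (hstp' s n) (by rw [(hip n _).2, one_mul])
        (csp s n).1 (csp s n).2
  have hqb : P.schedQb P.γb πb = qb := funext clb
  have hqp : P.schedQp s1 P.γp πp = qp := funext fun n => by
    rw [MarketNet.schedQp, clp, hr1, Pi.zero_apply, add_zero]
  refine ⟨πb, πp, ⟨hγb, hγp, fun n α _ => ?_, fun n α _ => ?_, ?_, fun s => ?_⟩, hqb, hqp,
    fun s => funext fun n => by rw [MarketNet.schedR, clp, hqp, add_sub_cancel_left]⟩
  · rw [clb]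
    have hy := le_clamp (x := α * P.sb n (πb n)) (hqlu n)
    have h0 := (hql n).trans_le ((hΩ s1).1 n).1
    have t := (hcb n).convexOn.sub_mul_le_of_kkt h0 ((hql n).trans_le hy) (hdb n _ h0) hK0.le
      (hξl n) (hξu n) (hstb' n) (csb n).1 (csb n).2 hy clamp_le
    linarith
  · refine Finset.sum_le_sum fun s _ => mul_le_mul_of_nonneg_left ?_ (hp s).le
    rw [clp]
    have hy := le_clamp (x := α * P.sp n (πp s n)) (hplu n)
    have h0 := (hpl n).trans_le ((hΩ s).2.1 n).1
    have t := (hcp n).convexOn.sub_mul_le_of_kkt h0 ((hpl n).trans_le hy) (hdp n _ h0)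
      zero_le_one (hνl s n) (hνu s n) (hstp' s n) (csp s n).1 (csp s n).2 hy clamp_le
    linarith
  · have hΩ1 := hΩ s1
    have csl1 := hcsl s1
    have stp1 := hstp s1
    have csp1 := hcsp s1
    simp only [hr1, Pi.zero_apply, add_zero] at hΩ1 csl1 stp1 csp1
    have kkt : P.EDHatKKT K δ P.γb P.γp (d s1) qb qp ξl ξu ((K : ℝ) • νl s1)
        ((K : ℝ) • νu s1) ((K : ℝ) • μl s1) ((K : ℝ) • μu s1) (K * lam s1) := by
      refine ⟨hξl, hξu, fun n => mul_nonneg hK0.le (hνl s1 n),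
        fun n => mul_nonneg hK0.le (hνu s1 n), fun l => mul_nonneg hK0.le (hμl s1 l),
        fun l => mul_nonneg hK0.le (hμu s1 l), fun n => ?_, fun n => ?_, hcsb, ?_, ?_⟩
      · rw [div_self (hγb n).ne', one_mul, P.price_mul, hstb', hKπb]
        simp [hπp]
      · rw [div_self (hγp n).ne', one_mul, P.price_mul, ← stp1]
        simp only [Pi.smul_apply, smul_eq_mul]
        ring
      · simp only [Pi.smul_apply, smul_eq_mul, mul_assoc, ← mul_add, ← Finset.mul_sum]
        rw [csp1, mul_zero]
      · simp only [Pi.smul_apply, smul_eq_mul, mul_assoc, ← mul_add, ← Finset.mul_sum]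
        rw [csl1, mul_zero]
    refine ⟨qb, qp, _, _, _, _, _, _, _, kkt.edHatOpt hP hΩ1, kkt, fun n => ?_, fun n => ?_⟩
    · rw [P.price_mul]
    · rw [P.price_mul, inv_mul_cancel_left₀ hK0.ne']
  · rw [hqb, hqp]
    have kkt : P.FRHatKKT P.γp (d s) qb qp (r s) (νl s) (νu s) (μl s) (μu s) (lam s) := by
      refine ⟨hνl s, hνu s, hμl s, hμu s, fun n => ?_, hcsp s, hcsl s⟩
      rw [div_self (hγp n).ne', one_mul, hstp]
    exact ⟨r s, _, _, _, _, _, kkt.frHatOpt hP (hΩ s), kkt, fun n => rfl⟩
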